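/- Let ∥ be a parallelism of P(V). Then there exists a plane C external to the Klein quadric such that for all lines M, N one has M ∥ N if and only if C + γM = C + γN (i.e., ∥ is Clifford) if and only if ∥ satisfies the condition of crossed pencils: for all lines M₁, M₂, N₁, N₂ with M₁ ∥ N₁ and M₂ ∥ N₂ such that p := M₁ ∩ M₂ and q := N₁ ∩ N₂ are 1-dimensional (points) with p ≠ q, if q ≤ M₁ + M₂ (i.e., M₁, M₂ and the line p + q lie in a common pencil) then p ≤ N₁ + N₂ (i.e., N₁, N₂ and the line p + q lie in a common pencil). -/

import Mathlib

open ExteriorAlgebra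

variable (F : Type*) [Field F] (V : Type*) [AddCommGroup V] [Module F V]

/-- An element of the second exterior power `⋀²V` is decomposable if it is the wedge
`u ∧ v` of two vectors of `V`. -/
def IsDecomposable (x : ⋀[F]^2 V) : Prop :=
  ∃ u v : V, (x : ExteriorAlgebra F V) = ι F u * ι F v

/-- A plane external to the Klein quadric: a 3-dimensional subspace of `⋀²V` containing
no nonzero decomposable element. -/
def IsExternalPlane (C : Submodule F ↥(⋀[F]^2 V)) : Prop :=
  Module.finrank F C = 3 ∧ ∀ x ∈ C, x ≠ 0 → ¬ IsDecomposable F V x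

/-- The Plücker point `γM` of a line `M` of `P(V)`: the subspace of `⋀²V` spanned by all
wedges `u ∧ v` with `u, v ∈ M`.  For a 2-dimensional `M` this is the 1-dimensional
subspace spanned by `u ∧ v`, where `{u, v}` is any basis of `M`. -/
def plueckerPoint (M : Submodule F V) : Submodule F ↥(⋀[F]^2 V) :=
  Submodule.span F {x : ⋀[F]^2 V | ∃ u ∈ M, ∃ v ∈ M, (x : ExteriorAlgebra F V) = ι F u * ι F v}

/-- The polar `X^⊥` of a subspace `X` of `⋀²V` with respect to the Klein quadric:
all `y` with `x ∧ y = 0` for every `x ∈ X`, the wedge being computed in the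
exterior algebra of `V` (it lands in the 1-dimensional space `⋀⁴V`). -/
def polarSubspace (X : Submodule F ↥(⋀[F]^2 V)) : Submodule F ↥(⋀[F]^2 V) where
  carrier := {y | ∀ x ∈ X, (x : ExteriorAlgebra F V) * (y : ExteriorAlgebra F V) = 0}
  add_mem' := by
    intro a b ha hb x hx
    rw [Submodule.coe_add, mul_add, ha x hx, hb x hx, add_zero]
  zero_mem' := by
    intro x hx
    simp
  smul_mem' := by
    intro c a ha x hx
    rw [Submodule.coe_smul, Algebra.mul_smul_comm, ha x hx, smul_zero]

section Linear

variable {F V}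

/-- A null polarity is symplectic: a family of nonzero functionals `f s` with `f s s = 0` and
symmetric vanishing comes, up to scalars, from an alternating bilinear form. -/
theorem exists_alternating_of_null_polarity (f : V → Module.Dual F V)
    (h0 : ∀ s, s ≠ 0 → f s ≠ 0) (hself : ∀ s, f s s = 0)
    (hsym : ∀ s t, s ≠ 0 → t ≠ 0 → f s t = 0 → f t s = 0) :
    ∃ ω : V →ₗ[F] V →ₗ[F] F, (∀ x, ω x x = 0) ∧
      ∀ s t, s ≠ 0 → (f s t = 0 ↔ ω s t = 0) := by
  by_cases hV : ∀ s : V, s = 0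
  · exact ⟨0, by simp, fun s _ hs => absurd (hV s) hs⟩
  push Not at hV
  obtain ⟨b, hb⟩ := hV
  obtain ⟨a, ha⟩ : ∃ a, f b a ≠ 0 := by
    by_contra! h
    exact h0 b hb (LinearMap.ext h)
  set l : Module.Dual F V := (f b a)⁻¹ • f b with hl
  have la : l a = 1 := by simp [hl, ha]
  have lzero : ∀ x, l x = 0 → f b x = 0 := by
    intro x hx
    simpa [hl, ha] using hx
  have lzero' : ∀ x, f b x = 0 → l x = 0 := by
    intro x hx
    simp [hl, hx]
  have fb : ∀ x, l x = 1 → f x b ≠ 0 := by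
    intro x hx h
    have hx0 : x ≠ 0 := by rintro rfl; simp at hx
    have := lzero' x (hsym x b hx0 hb h)
    simp [this] at hx
  set g : V → Module.Dual F V := fun x => (f x b)⁻¹ • f x with hg
  have hspan : ∀ x y z, x ≠ 0 → y ≠ 0 → z ≠ 0 → x = y + z →
      ∃ α β : F, α • f y + β • f z = f x := by
    intro x y z hx hy hz hxyz
    rw [← Submodule.mem_span_pair]
    have : f x ∈ Submodule.span F (Set.range ![f y, f z]) := by
      apply mem_span_of_iInf_ker_le_ker
      intro t ht
      simp only [Submodule.mem_iInf, LinearMap.mem_ker] at ht ⊢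
      have h1 : f y t = 0 := ht 0
      have h2 : f z t = 0 := ht 1
      by_cases ht0 : t = 0
      · simp [ht0]
      apply hsym t x ht0 hx
      rw [hxyz, map_add, hsym _ _ hy ht0 h1, hsym _ _ hz ht0 h2, add_zero]
    rwa [Matrix.range_cons, Matrix.range_cons, Matrix.range_empty, Set.union_empty,
      Set.singleton_union] at this
  have key : ∀ x y, l x = 1 → l y = 1 → g x y = - g y x := by
    intro x y hx hy
    by_cases hxy : x = y
    · subst hxy
      simp [hg, hself]
    have hx0 : x ≠ 0 := by rintro rfl; simp at hx
    have hy0 : y ≠ 0 := by rintro rfl; simp at hy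
    have hz0 : x - y ≠ 0 := sub_ne_zero.mpr hxy
    have hzb : f (x - y) b = 0 :=
      hsym b _ hb hz0 (lzero _ (by rw [map_sub, hx, hy, sub_self]))
    obtain ⟨α, β, hαβ⟩ := hspan x y (x - y) hx0 hy0 hz0 (by abel)
    have e1 : f x b = α * f y b := by
      rw [← hαβ]; simp [hzb]
    have e2 : f x y = - (α * f y x) := by
      have h5 : f x (x - y) = α * f y (x - y) := by
        conv_lhs => rw [← hαβ]
        simp [hself]
      rw [map_sub, map_sub, hself, hself] at h5
      linear_combination -h5
    have hα : α ≠ 0 := by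
      rintro rfl
      exact fb x hx (by simpa using e1)
    have hyb := fb y hy
    simp only [hg, LinearMap.smul_apply, smul_eq_mul, e1, e2]
    field_simp
  have gker : ∀ x t, l x = 1 → (f x t = 0 ↔ g x t = 0) := by
    intro x t hx
    simp [hg, fb x hx]
  set N : V → V := fun x => x + (1 - l x) • a with hN
  have lN : ∀ x, l (N x) = 1 := by intro x; simp [hN, la]
  set Ω : V → V → F := fun x y => g (N x) y - (1 - l x) * g a y with hΩ
  have hanti : ∀ x y, Ω x y = - Ω y x := by
    intro x y
    have h1 : y = N y - (1 - l y) • a := by simp [hN]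
    have h2 : x = N x - (1 - l x) • a := by simp [hN]
    have e1 : g (N x) y = g (N x) (N y) - (1 - l y) * g (N x) a := by
      conv_lhs => rw [h1]
      simp
    have e2 : g (N y) x = g (N y) (N x) - (1 - l x) * g (N y) a := by
      conv_lhs => rw [h2]
      simp
    have e3 : g a y = g a (N y) := by
      have h3 : g a a = 0 := by simp [hg, hself]
      conv_lhs => rw [h1]
      simp [h3]
    have e4 : g a x = g a (N x) := by
      have h3 : g a a = 0 := by simp [hg, hself]
      conv_lhs => rw [h2]
      simp [h3]
    simp only [hΩ]
    rw [e1, e2, e3, e4, key _ _ (lN x) (lN y), key _ _ (lN x) la, key _ _ (lN y) la]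
    ring
  have hadd : ∀ x y z, Ω x (y + z) = Ω x y + Ω x z := by
    intro x y z; simp only [hΩ, map_add]; ring
  have hsmul : ∀ (c : F) x y, Ω x (c • y) = c * Ω x y := by
    intro c x y; simp only [hΩ, map_smul, smul_eq_mul]; ring
  have hdiag : ∀ x, Ω x x = 0 := by
    intro x
    have h2 : x = N x - (1 - l x) • a := by simp [hN]
    have h3 : ∀ y, g y y = 0 := fun y => by simp [hg, hself]
    have e1 : g (N x) x = - ((1 - l x) * g (N x) a) := by
      have := congrArg (g (N x)) h2
      rw [map_sub, map_smul, h3, zero_sub, smul_eq_mul] at this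
      exact this
    have e2 : g a x = g a (N x) := by
      conv_lhs => rw [h2]
      simp [h3]
    simp only [hΩ]
    rw [e1, e2, key _ _ (lN x) la]
    ring
  let ω : V →ₗ[F] V →ₗ[F] F := LinearMap.mk₂ F Ω
    (fun x y z => by rw [hanti, hadd, hanti x, hanti y]; ring)
    (fun c x y => by rw [hanti, hsmul, hanti x]; simp)
    hadd hsmul
  have ωg : ∀ x y, l x = 1 → ω x y = g x y := by
    intro x y hx
    change Ω x y = _
    simp [hΩ, hN, hx]
  have hωanti : ∀ x y, ω x y = - ω y x := hanti
  have off : ∀ s t, l s ≠ 0 → (f s t = 0 ↔ ω s t = 0) := by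
    intro s t hs
    have hs0 : s ≠ 0 := by rintro rfl; simp at hs
    have hu0 : (l s)⁻¹ • s ≠ 0 := smul_ne_zero (inv_ne_zero hs) hs0
    have hu : l ((l s)⁻¹ • s) = 1 := by simp [hs]
    have h1 : f s t = 0 ↔ f ((l s)⁻¹ • s) t = 0 := by
      by_cases ht : t = 0
      · simp [ht]
      constructor
      · intro h
        apply hsym _ _ ht hu0
        rw [map_smul, hsym _ _ hs0 ht h, smul_zero]
      · intro h
        apply hsym _ _ ht hs0
        have := hsym _ _ hu0 ht h
        simpa [hs] using this
    rw [h1, gker _ _ hu, ← ωg _ _ hu]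
    simp [hs]
  refine ⟨ω, hdiag, fun s t hs => ?_⟩
  by_cases hls : l s = 0
  swap
  · exact off s t hls
  have offsym : ∀ t, l t ≠ 0 → (f s t = 0 ↔ ω s t = 0) := by
    intro t ht
    have ht0 : t ≠ 0 := by rintro rfl; simp at ht
    rw [hωanti s t, neg_eq_zero, ← off t s ht]
    exact ⟨hsym _ _ hs ht0, hsym _ _ ht0 hs⟩
  have hla : l (a + s) = 1 := by simp [la, hls]
  have hsb : f s b = 0 := hsym _ _ hb hs (lzero _ hls)
  have ha0 : a ≠ 0 := by rintro h; simp [h] at la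
  have has0 : a + s ≠ 0 := by rintro h; simp [h] at hla
  obtain ⟨α, β, hαβ⟩ := hspan (a + s) a s has0 ha0 hs rfl
  have hα : f (a + s) b = α * f a b := by rw [← hαβ]; simp [hsb]
  have hab := fb a la
  have hasb := fb _ hla
  have hω : ∀ y, ω s y = (f (a + s) b)⁻¹ * β * f s y := by
    intro y
    have h1 : ω s y = ω (a + s) y - ω a y := by simp
    rw [h1, ωg _ _ hla, ωg _ _ la]
    simp only [hg, LinearMap.smul_apply, smul_eq_mul]
    have h2 : f (a + s) y = α * f a y + β * f s y := by
      conv_lhs => rw [← hαβ]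
      simp
    have hα0 : α ≠ 0 := by rintro rfl; exact hasb (by simpa using hα)
    rw [h2, hα]
    field_simp
    ring
  have hβ : β ≠ 0 := by
    rintro rfl
    have hoff : ∀ y, l y ≠ 0 → f s y = 0 := fun y hy => (offsym y hy).2 (by simp [hω])
    apply h0 s hs
    ext y
    by_cases hy : l y = 0
    · have h1 := hoff (a + y) (by simp [la, hy])
      rw [map_add, hoff a (by simp [la]), zero_add] at h1
      simpa using h1
    · simpa using hoff y hy
  rw [hω]
  simp [hβ, hasb]

end Linear

section Incidence

variable {F V} [FiniteDimensional F V]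

open Module (finrank)

theorem finrank_span_pair_of_notMem {u v : V} (hu : u ≠ 0) (hv : v ∉ Submodule.span F {u}) :
    finrank F (Submodule.span F {u, v}) = 2 := by
  rw [Set.pair_comm, Submodule.span_insert, sup_comm, Submodule.finrank_sup_span_singleton hv,
    finrank_span_singleton hu]

theorem exists_mem_notMem_of_finrank_lt {A B : Submodule F V} (h : finrank F A < finrank F B) :
    ∃ v ∈ B, v ∉ A := by
  by_contra! hc
  exact absurd (Submodule.finrank_mono (show B ≤ A from hc)) (by omega)

/-- Any two vectors of a subspace of dimension at least two lie on a line in that subspace. -/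
theorem exists_line_le {E : Submodule F V} (hE : 2 ≤ finrank F E) {u v : V}
    (hu : u ∈ E) (hv : v ∈ E) :
    ∃ N ≤ E, finrank F N = 2 ∧ u ∈ N ∧ v ∈ N := by
  have nonzero : ∀ w ∈ E, w ≠ 0 → ∀ w' ∈ E, ∃ N ≤ E, finrank F N = 2 ∧ w ∈ N ∧ w' ∈ N := by
    intro w hw hw0 w' hw'
    obtain ⟨z, hzE, hz, hwz⟩ : ∃ z ∈ E, z ∉ Submodule.span F {w} ∧
        w' ∈ Submodule.span F {w, z} := by
      by_cases h : w' ∈ Submodule.span F {w}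
      · obtain ⟨z, hzE, hz⟩ := exists_mem_notMem_of_finrank_lt
          (A := Submodule.span F {w}) (B := E) (by rw [finrank_span_singleton hw0]; omega)
        exact ⟨z, hzE, hz, Submodule.span_mono (by simp) h⟩
      · exact ⟨w', hw', h, Submodule.subset_span (by simp)⟩
    refine ⟨Submodule.span F {w, z}, ?_, finrank_span_pair_of_notMem hw0 hz,
      Submodule.subset_span (by simp), hwz⟩
    rw [Submodule.span_le]
    rintro x (rfl | rfl)
    exacts [hw, hzE]
  by_cases hu0 : u = 0
  · subst hu0
    by_cases hv0 : v = 0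
    · subst hv0
      obtain ⟨w, hw, hw0⟩ := exists_mem_notMem_of_finrank_lt (A := (⊥ : Submodule F V)) (B := E)
        (by rw [finrank_bot]; omega)
      obtain ⟨N, hN, h2, -, -⟩ := nonzero w hw (by simpa using hw0) w hw
      exact ⟨N, hN, h2, N.zero_mem, N.zero_mem⟩
    · obtain ⟨N, hN, h2, h, -⟩ := nonzero v hv hv0 v hv
      exact ⟨N, hN, h2, N.zero_mem, h⟩
  · exact nonzero u hu hu0 v hv

/-- Two distinct lines through a common point have that point as intersection. -/
theorem finrank_inf_of_ne {M N : Submodule F V} (hM : finrank F M = 2) (hN : finrank F N = 2)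
    (hne : M ≠ N) {v : V} (hv : v ≠ 0) (hvM : v ∈ M) (hvN : v ∈ N) :
    finrank F ↥(M ⊓ N) = 1 := by
  have h1 : finrank F (Submodule.span F {v}) ≤ finrank F ↥(M ⊓ N) :=
    Submodule.finrank_mono (by simp [Submodule.span_le, hvM, hvN])
  rw [finrank_span_singleton hv] at h1
  have h2 : finrank F ↥(M ⊓ N) < finrank F M := by
    apply Submodule.finrank_lt_finrank_of_lt
    refine lt_of_le_of_ne inf_le_left fun h => hne ?_
    exact Submodule.eq_of_le_of_finrank_eq (inf_eq_left.mp h) (hM.trans hN.symm)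
  omega

theorem inf_eq_span_of_ne {M N : Submodule F V} (hM : finrank F M = 2) (hN : finrank F N = 2)
    (hne : M ≠ N) {v : V} (hv : v ≠ 0) (hvM : v ∈ M) (hvN : v ∈ N) :
    M ⊓ N = Submodule.span F {v} := by
  symm
  apply Submodule.eq_of_le_of_finrank_eq
  · simp [Submodule.span_le, hvM, hvN]
  · rw [finrank_inf_of_ne hM hN hne hv hvM hvN, finrank_span_singleton hv]

theorem finrank_sup_of_ne {M N : Submodule F V} (hM : finrank F M = 2) (hN : finrank F N = 2)
    (hne : M ≠ N) {v : V} (hv : v ≠ 0) (hvM : v ∈ M) (hvN : v ∈ N) :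
    finrank F ↥(M ⊔ N) = 3 := by
  have h1 := finrank_inf_of_ne hM hN hne hv hvM hvN
  have h2 := Submodule.finrank_sup_add_finrank_inf_eq M N
  omega

theorem sup_eq_of_le {M N E : Submodule F V} (hM : finrank F M = 2) (hN : finrank F N = 2)
    (hE : finrank F E = 3) (hne : M ≠ N) {v : V} (hv : v ≠ 0) (hvM : v ∈ M) (hvN : v ∈ N)
    (hME : M ≤ E) (hNE : N ≤ E) : M ⊔ N = E :=
  Submodule.eq_of_le_of_finrank_eq (sup_le hME hNE)
    ((finrank_sup_of_ne hM hN hne hv hvM hvN).trans hE.symm)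

theorem le_of_mem_sup {M N E : Submodule F V} (hM : finrank F M = 2) (hN : finrank F N = 2)
    (hE : finrank F E = 3) (hne : M ≠ N) {v : V} (hv : v ≠ 0) (hvM : v ∈ M) (hvN : v ∈ N)
    (hME : M ≤ E) {w : V} (hwE : w ∈ E) (hwM : w ∉ M) (hw : w ∈ M ⊔ N) : N ≤ E := by
  have h3 := Submodule.finrank_sup_span_singleton hwM
  have h1 : M ⊔ Submodule.span F {w} = E := by
    apply Submodule.eq_of_le_of_finrank_eq
    · exact sup_le hME (by simpa [Submodule.span_le] using hwE)
    · omega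
  have h2 : M ⊔ Submodule.span F {w} = M ⊔ N := by
    apply Submodule.eq_of_le_of_finrank_eq
    · exact sup_le le_sup_left (by simpa [Submodule.span_le] using hw)
    · rw [h3, finrank_sup_of_ne hM hN hne hv hvM hvN, hM]
  rw [← h1, h2]
  exact le_sup_right

/-- A line of a 4-dimensional space meets every plane. -/
theorem exists_ne_zero_mem_line_plane (hV : finrank F V = 4) {N E : Submodule F V}
    (hN : finrank F N = 2) (hE : finrank F E = 3) : ∃ v ≠ 0, v ∈ N ∧ v ∈ E := by
  have h1 := Submodule.finrank_sup_add_finrank_inf_eq N E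
  have h2 := Submodule.finrank_le (N ⊔ E)
  obtain ⟨v, hv, hv0⟩ := exists_mem_notMem_of_finrank_lt (A := (⊥ : Submodule F V)) (B := N ⊓ E)
    (by rw [finrank_bot]; omega)
  exact ⟨v, by simpa using hv0, hv.1, hv.2⟩

end Incidence

section Parallelism

variable {F V} [FiniteDimensional F V]

open Module (finrank)

/-- `P` is a parallelism of lines, with points given by nonzero vectors. -/
structure IsParallelism (P : Submodule F V → Submodule F V → Prop) : Prop where
  finrank_left : ∀ {M N}, P M N → finrank F M = 2
  finrank_right : ∀ {M N}, P M N → finrank F N = 2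
  refl : ∀ {M : Submodule F V}, finrank F M = 2 → P M M
  symm : ∀ {M N}, P M N → P N M
  trans : ∀ {L M N}, P L M → P M N → P L N
  exists_line : ∀ {v : V} {M : Submodule F V}, v ≠ 0 → finrank F M = 2 → ∃ N, v ∈ N ∧ P N M
  unique : ∀ {v : V} {M N}, P M N → v ≠ 0 → v ∈ M → v ∈ N → M = N

/-- The condition of crossed pencils, with points given by nonzero vectors. -/
def CrossedPencils (P : Submodule F V → Submodule F V → Prop) : Prop :=
  ∀ ⦃M₁ M₂ N₁ N₂ : Submodule F V⦄ ⦃p q : V⦄, P M₁ N₁ → P M₂ N₂ → M₁ ≠ M₂ → p ≠ 0 → q ≠ 0 →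
    p ∈ M₁ → p ∈ M₂ → q ∈ N₁ → q ∈ N₂ → q ∉ Submodule.span F {p} → q ∈ M₁ ⊔ M₂ → p ∈ N₁ ⊔ N₂

variable {P : Submodule F V → Submodule F V → Prop}

/-- Under the condition of crossed pencils, the pencil of lines through `p` in a plane `E` is
mapped by parallelism to a pencil of lines through any other point `q` of `E`. -/
theorem CrossedPencils.exists_plane_of_mem (hC : CrossedPencils P) (hP : IsParallelism P)
    {p q : V} {E : Submodule F V} (hp : p ≠ 0) (hq : q ∉ Submodule.span F {p})
    (hE : finrank F E = 3) (hpE : p ∈ E) (hqE : q ∈ E) :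
    ∃ E' : Submodule F V, finrank F E' = 3 ∧ p ∈ E' ∧ q ∈ E' ∧
      ∀ M N, P M N → p ∈ M → q ∈ N → (M ≤ E ↔ N ≤ E') := by
  have hq0 : q ≠ 0 := by rintro rfl; exact hq (Submodule.zero_mem _)
  have hp' : p ∉ Submodule.span F {q} := by
    intro h
    obtain ⟨c, rfl⟩ := Submodule.mem_span_singleton.mp h
    have hc : c ≠ 0 := by rintro rfl; simp at hp
    exact hq (Submodule.mem_span_singleton.mpr ⟨c⁻¹, by simp [smul_smul, hc]⟩)
  have hL : finrank F (Submodule.span F {p, q}) = 2 := finrank_span_pair_of_notMem hp hq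
  obtain ⟨u, huE, hu⟩ := exists_mem_notMem_of_finrank_lt
    (A := Submodule.span F {p, q}) (B := E) (by omega)
  obtain ⟨M₁, hM₁E, hM₁, hpM₁, huM₁⟩ := exists_line_le (E := E) (by omega) hpE huE
  have hqM₁ : q ∉ M₁ := by
    intro h
    apply hu
    have h1 : Submodule.span F {p, q} = M₁ := by
      apply Submodule.eq_of_le_of_finrank_eq _ (hL.trans hM₁.symm)
      rw [Submodule.span_le]
      rintro x (rfl | rfl)
      exacts [hpM₁, h]
    rwa [h1]
  obtain ⟨N₁, hqN₁, hNM₁⟩ := hP.exists_line hq0 hM₁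
  have hN₁ := hP.finrank_left hNM₁
  have hpN₁ : p ∉ N₁ := fun h => hqM₁ (hP.unique hNM₁ hp h hpM₁ ▸ hqN₁)
  have hpE' : p ∈ N₁ ⊔ Submodule.span F {p} :=
    Submodule.mem_sup_right (Submodule.mem_span_singleton_self p)
  have hE' : finrank F ↥(N₁ ⊔ Submodule.span F {p}) = 3 := by
    rw [Submodule.finrank_sup_span_singleton hpN₁, hN₁]
  refine ⟨N₁ ⊔ Submodule.span F {p}, hE', hpE', Submodule.mem_sup_left hqN₁, ?_⟩
  intro M N hMN hpM hqN
  have hM := hP.finrank_left hMN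
  have hN := hP.finrank_right hMN
  by_cases h : M₁ = M
  · subst h
    have : N₁ = N := hP.unique (hP.trans hNM₁ hMN) hq0 hqN₁ hqN
    subst this
    exact ⟨fun _ => le_sup_left, fun _ => hM₁E⟩
  have h' : N₁ ≠ N := by
    rintro rfl
    exact h (hP.unique (hP.symm (hP.trans hMN hNM₁)) hp hpM₁ hpM)
  constructor
  · intro hME
    have h1 : q ∈ M₁ ⊔ M := by rwa [sup_eq_of_le hM₁ hM hE h hp hpM₁ hpM hM₁E hME]
    have h2 := hC (hP.symm hNM₁) hMN h hp hq0 hpM₁ hpM hqN₁ hqN hq h1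
    exact le_of_mem_sup hN₁ hN hE' h' hq0 hqN₁ hqN le_sup_left hpE' hpN₁ h2
  · intro hNE
    have h1 : p ∈ N₁ ⊔ N := by rwa [sup_eq_of_le hN₁ hN hE' h' hq0 hqN₁ hqN le_sup_left hNE]
    have h2 := hC hNM₁ (hP.symm hMN) h' hq0 hp hqN₁ hqN hpM₁ hpM hp' h1
    exact le_of_mem_sup hM₁ hM hE h hp hpM₁ hpM hM₁E hqE hqM₁ h2

/-- Under the condition of crossed pencils, parallelism maps pencils of lines through `p` to
pencils of lines through any other point `s`. -/
theorem CrossedPencils.exists_plane (hC : CrossedPencils P) (hP : IsParallelism P)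
    (hV : finrank F V = 4) {p s : V} {E : Submodule F V} (hp : p ≠ 0) (hs : s ≠ 0)
    (hE : finrank F E = 3) (hpE : p ∈ E) :
    ∃ E' : Submodule F V, finrank F E' = 3 ∧ s ∈ E' ∧
      ∀ M N, P M N → p ∈ M → s ∈ N → (M ≤ E ↔ N ≤ E') := by
  by_cases hsp : s ∈ Submodule.span F {p}
  · obtain ⟨c, rfl⟩ := Submodule.mem_span_singleton.mp hsp
    refine ⟨E, hE, E.smul_mem c hpE, fun M N hMN hpM hN => ?_⟩
    rw [hP.unique hMN hs (M.smul_mem c hpM) hN]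
  by_cases hsE : s ∈ E
  · obtain ⟨E', hE', -, hsE', h⟩ := hC.exists_plane_of_mem hP hp hsp hE hpE hsE
    exact ⟨E', hE', hsE', h⟩
  obtain ⟨M, hME, hM, hpM, -⟩ := exists_line_le (E := E) (by omega) hpE hpE
  obtain ⟨N, hsN, hNM⟩ := hP.exists_line hs hM
  obtain ⟨r, hr, hrN, hrE⟩ := exists_ne_zero_mem_line_plane hV (hP.finrank_left hNM) hE
  have hrp : r ∉ Submodule.span F {p} := by
    intro h
    obtain ⟨c, rfl⟩ := Submodule.mem_span_singleton.mp h
    exact hsE (hME (hP.unique hNM hr hrN (M.smul_mem c hpM) ▸ hsN))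
  obtain ⟨E₁, hE₁, -, hrE₁, h₁⟩ := hC.exists_plane_of_mem hP hp hrp hE hpE hrE
  have hNE₁ : N ≤ E₁ := (h₁ M N (hP.symm hNM) hpM hrN).1 hME
  have hsr : s ∉ Submodule.span F {r} := by
    intro h
    obtain ⟨c, rfl⟩ := Submodule.mem_span_singleton.mp h
    exact hsE (E.smul_mem c hrE)
  obtain ⟨E₂, hE₂, -, hsE₂, h₂⟩ := hC.exists_plane_of_mem hP hr hsr hE₁ hrE₁ (hNE₁ hsN)
  refine ⟨E₂, hE₂, hsE₂, fun K K' hK hpK hsK => ?_⟩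
  obtain ⟨L, hrL, hLK⟩ := hP.exists_line hr (hP.finrank_left hK)
  rw [h₁ K L (hP.symm hLK) hpK hrL, h₂ L K' (hP.trans hLK hK) hrL hsK]

/-- The lines parallel to lines through `e` in the plane `ker φ` are the totally isotropic lines
of an alternating form `ω` with `ω e = φ`. -/
theorem CrossedPencils.exists_form (hC : CrossedPencils P) (hP : IsParallelism P)
    (hV : finrank F V = 4) {e : V} (he : e ≠ 0) (φ : Module.Dual F V) (hφ : φ e = 0) :
    ∃ ω : V →ₗ[F] V →ₗ[F] F, (∀ x, ω x x = 0) ∧ ω e = φ ∧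
      (∀ M N, P M N → e ∈ M → M ≤ LinearMap.ker φ → ∀ s ∈ N, ∀ t ∈ N, ω s t = 0) ∧
      (∀ M N, P M N → e ∈ M → ∀ s ∈ N, ∀ t ∈ N, t ∉ Submodule.span F {s} → s ≠ 0 →
        ω s t = 0 → M ≤ LinearMap.ker φ) := by
  by_cases hφ0 : φ = 0
  · subst hφ0
    exact ⟨0, by simp, rfl, by simp, by simp⟩
  have hE : finrank F (LinearMap.ker φ) = 3 := by
    have := Module.Dual.finrank_ker_add_one_of_ne_zero hφ0
    omega
  have heE : e ∈ LinearMap.ker φ := hφ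
  have hplane : ∀ s : V, ∃ f : Module.Dual F V, f s = 0 ∧ (s ≠ 0 → f ≠ 0 ∧
      ∀ M N, P M N → e ∈ M → s ∈ N → (M ≤ LinearMap.ker φ ↔ N ≤ LinearMap.ker f)) := by
    intro s
    by_cases hs : s = 0
    · exact ⟨0, by simp, fun h => absurd hs h⟩
    obtain ⟨E', hE', hsE', h⟩ := hC.exists_plane hP hV he hs hE heE
    obtain ⟨f, hf0, hf⟩ := Submodule.exists_le_ker_of_lt_top E'
      (Submodule.lt_top_of_finrank_lt_finrank (by omega))
    have hE'f : E' = LinearMap.ker f := by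
      apply Submodule.eq_of_le_of_finrank_eq hf
      have := Module.Dual.finrank_ker_add_one_of_ne_zero hf0
      omega
    subst hE'f
    exact ⟨f, hsE', fun _ => ⟨hf0, h⟩⟩
  choose f hfs hf using hplane
  have hcrit : ∀ s t, s ≠ 0 → (f s t = 0 ↔
      ∃ M N, P M N ∧ e ∈ M ∧ s ∈ N ∧ t ∈ N ∧ M ≤ LinearMap.ker φ) := by
    intro s t hs
    have hfr := Module.Dual.finrank_ker_add_one_of_ne_zero (hf s hs).1
    constructor
    · intro h
      obtain ⟨N, hN, hN2, hsN, htN⟩ := exists_line_le (E := LinearMap.ker (f s)) (by omega)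
        (hfs s) h
      obtain ⟨M, heM, hMN⟩ := hP.exists_line he hN2
      exact ⟨M, N, hMN, heM, hsN, htN, ((hf s hs).2 M N hMN heM hsN).2 hN⟩
    · rintro ⟨M, N, hMN, heM, hsN, htN, hM⟩
      exact ((hf s hs).2 M N hMN heM hsN).1 hM htN
  obtain ⟨ω, hω, hωf⟩ := exists_alternating_of_null_polarity f (fun s hs => (hf s hs).1) hfs
    (by
      intro s t hs ht h
      obtain ⟨M, N, hMN, heM, hsN, htN, hM⟩ := (hcrit s t hs).1 h
      exact (hcrit t s ht).2 ⟨M, N, hMN, heM, htN, hsN, hM⟩)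
  have hωe : ∀ t, ω e t = 0 ↔ φ t = 0 := by
    intro t
    rw [← hωf e t he, hcrit e t he]
    constructor
    · rintro ⟨M, N, hMN, heM, heN, htN, hM⟩
      exact hM (hP.unique hMN he heM heN ▸ htN)
    · intro h
      obtain ⟨N, hN, hN2, heN, htN⟩ := exists_line_le (E := LinearMap.ker φ) (by omega) heE h
      exact ⟨N, N, hP.refl hN2, heN, heN, htN, hN⟩
  obtain ⟨z, hz⟩ : ∃ z, φ z ≠ 0 := by
    by_contra! h
    exact hφ0 (LinearMap.ext h)
  have hωz : ω e z ≠ 0 := fun h => hz ((hωe z).1 h)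
  have hc : φ z / ω e z ≠ 0 := div_ne_zero hz hωz
  refine ⟨(φ z / ω e z) • ω, by simp [hω], ?_, ?_, ?_⟩
  · ext t
    have h : ω e (t - (φ t / φ z) • z) = 0 := by
      rw [hωe]
      simp [hz]
    simp only [map_sub, map_smul, smul_eq_mul, sub_eq_zero] at h
    simp only [LinearMap.smul_apply, smul_eq_mul, h]
    field_simp
  · intro M N hMN heM hM s hs t ht
    by_cases hs0 : s = 0
    · simp [hs0]
    · simp [(hωf s t hs0).1 ((hcrit s t hs0).2 ⟨M, N, hMN, heM, hs, ht, hM⟩)]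
  · intro M N hMN heM s hs t ht hts hs0 h
    have h1 : f s t = 0 := (hωf s t hs0).2 (by simpa [hc, hωz, hz] using h)
    refine ((hf s hs0).2 M N hMN heM hs).2 ?_
    have h2 : Submodule.span F {s, t} = N := by
      apply Submodule.eq_of_le_of_finrank_eq
      · rw [Submodule.span_le]
        rintro x (rfl | rfl)
        exacts [hs, ht]
      · rw [finrank_span_pair_of_notMem hs0 hts, hP.finrank_right hMN]
    rw [← h2, Submodule.span_le]
    rintro x (rfl | rfl)
    exacts [hfs _, h1]

/-- An alternating form with `e` in its radical that vanishes on all lines parallel to some line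
through `e` is zero. -/
theorem IsParallelism.form_eq_zero (hP : IsParallelism P) (hV : finrank F V = 4)
    {e : V} (he : e ≠ 0) {M : Submodule F V} (hM : finrank F M = 2) (heM : e ∈ M)
    (D : V →ₗ[F] V →ₗ[F] F) (hD : ∀ x, D e x = 0)
    (hDM : ∀ N, P M N → ∀ s ∈ N, ∀ t ∈ N, D s t = 0) : D = 0 := by
  have hoff : ∀ s, s ∉ M → D s = 0 := by
    intro s hs
    have hs0 : s ≠ 0 := by rintro rfl; exact hs M.zero_mem
    have hse : s + e ∉ M := fun h => hs ((Submodule.add_mem_iff_left M heM).1 h)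
    have hse0 : s + e ≠ 0 := fun h => hse (h ▸ M.zero_mem)
    obtain ⟨N, hsN, hN⟩ := hP.exists_line hs0 hM
    obtain ⟨K, hsK, hK⟩ := hP.exists_line hse0 hM
    have hinf : N ⊓ K = ⊥ := by
      rw [Submodule.eq_bot_iff]
      intro v hv
      by_contra hv0
      have h1 : N = K := hP.unique (hP.trans hN (hP.symm hK)) hv0 hv.1 hv.2
      subst h1
      have h2 : e ∈ N := (Submodule.add_mem_iff_right N hsN).1 hsK
      exact hs (hP.unique hN he h2 heM ▸ hsN)
    have htop : N ⊔ K = ⊤ := by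
      apply Submodule.eq_top_of_finrank_eq
      have h1 := Submodule.finrank_sup_add_finrank_inf_eq N K
      rw [hinf, finrank_bot, hP.finrank_left hN, hP.finrank_left hK] at h1
      omega
    rw [← LinearMap.ker_eq_top, eq_top_iff, ← htop]
    refine sup_le (fun t ht => hDM N (hP.symm hN) s hsN t ht) fun t ht => ?_
    have := hDM K (hP.symm hK) _ hsK t ht
    rw [map_add, LinearMap.add_apply, hD, add_zero] at this
    exact this
  refine LinearMap.ext fun s => ?_
  by_cases hs : s ∈ M
  · obtain ⟨t, -, ht⟩ := exists_mem_notMem_of_finrank_lt (A := M) (B := ⊤)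
      (by rw [finrank_top]; omega)
    have h := hoff (s + t) fun h => ht ((Submodule.add_mem_iff_right M hs).1 h)
    rwa [map_add, hoff t ht, add_zero] at h
  · exact hoff s hs

end Parallelism

section Bilinear

variable {F V} [FiniteDimensional F V]

open Module (finrank)

variable {P : Submodule F V → Submodule F V → Prop}

/-- The alternating forms attached to the planes through `e` combine to an alternating map with
values in `V ⧸ ⟨e⟩` that sends each line to its parallel through `e`. -/
theorem CrossedPencils.exists_alternating (hC : CrossedPencils P) (hP : IsParallelism P)
    (hV : finrank F V = 4) {e : V} (he : e ≠ 0) :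
    ∃ W : V →ₗ[F] V →ₗ[F] (V ⧸ Submodule.span F {e}), (∀ x, W x x = 0) ∧
      W e = (Submodule.span F {e}).mkQ ∧
      (∀ M N, P M N → e ∈ M → ∀ s ∈ N, ∀ t ∈ N, W s t ∈ M.map (Submodule.span F {e}).mkQ) ∧
      ∀ s t, s ≠ 0 → t ∉ Submodule.span F {s} → W s t ≠ 0 := by
  set π := (Submodule.span F {e}).mkQ with hπ
  have hπe : π e = 0 := by simp [hπ]
  have hform := fun a : Module.Dual F (V ⧸ Submodule.span F {e}) =>
    hC.exists_form hP hV he (a ∘ₗ π) (by simp [hπe])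
  choose ω hω hωe hωP hωP' using hform
  have hline : ∀ a b : Module.Dual F (V ⧸ Submodule.span F {e}), ∃ M : Submodule F V,
      finrank F M = 2 ∧ e ∈ M ∧ M ≤ LinearMap.ker (a ∘ₗ π) ∧ M ≤ LinearMap.ker (b ∘ₗ π) := by
    intro a b
    have h2 : 2 ≤ finrank F ↥(LinearMap.ker ((a ∘ₗ π).prod (b ∘ₗ π))) := by
      have h1 := LinearMap.finrank_range_add_finrank_ker ((a ∘ₗ π).prod (b ∘ₗ π))
      have h3 := Submodule.finrank_le (LinearMap.range ((a ∘ₗ π).prod (b ∘ₗ π)))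
      rw [Module.finrank_prod, Module.finrank_self] at h3
      omega
    have heker : e ∈ LinearMap.ker ((a ∘ₗ π).prod (b ∘ₗ π)) := by simp [hπe]
    obtain ⟨M, hM, hM2, heM, -⟩ := exists_line_le h2 heker heker
    rw [LinearMap.ker_prod] at hM
    exact ⟨M, hM2, heM, hM.trans inf_le_left, hM.trans inf_le_right⟩
  let Λ : Module.Dual F (V ⧸ Submodule.span F {e}) →ₗ[F] V →ₗ[F] V →ₗ[F] F :=
    { toFun := ω
      map_add' := by
        intro a b
        obtain ⟨M, hM, heM, hMa, hMb⟩ := hline a b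
        have hMab : M ≤ LinearMap.ker ((a + b) ∘ₗ π) := by
          intro x hx
          have h1 : a (π x) = 0 := hMa hx
          have h2 : b (π x) = 0 := hMb hx
          simp [h1, h2]
        rw [← sub_eq_zero]
        apply hP.form_eq_zero hV he hM heM
        · intro x
          simp [hωe]
        · intro N hN s hs t ht
          simp [hωP _ M N hN heM hMa s hs t ht, hωP _ M N hN heM hMb s hs t ht,
            hωP _ M N hN heM hMab s hs t ht]
      map_smul' := by
        intro c a
        obtain ⟨M, hM, heM, hMa, -⟩ := hline a a
        have hMc : M ≤ LinearMap.ker ((c • a) ∘ₗ π) := by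
          intro x hx
          have h1 : a (π x) = 0 := hMa hx
          simp [h1]
        rw [← sub_eq_zero]
        apply hP.form_eq_zero hV he hM heM
        · intro x
          simp [hωe]
        · intro N hN s hs t ht
          simp [hωP _ M N hN heM hMa s hs t ht, hωP _ M N hN heM hMc s hs t ht] }
  let ev := (Module.evalEquiv F (V ⧸ Submodule.span F {e})).symm
  let W : V →ₗ[F] V →ₗ[F] (V ⧸ Submodule.span F {e}) := LinearMap.mk₂ F
    (fun s t => ev ((LinearMap.applyₗ t ∘ₗ LinearMap.applyₗ s) ∘ₗ Λ))
    (fun x y z => by rw [← map_add]; congr 1; ext a; simp)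
    (fun c x y => by rw [← map_smul]; congr 1; ext a; simp)
    (fun x y z => by rw [← map_add]; congr 1; ext a; simp)
    (fun c x y => by rw [← map_smul]; congr 1; ext a; simp)
  have hW : ∀ a s t, a (W s t) = ω a s t := by
    intro a s t
    simp only [W, ev, LinearMap.mk₂_apply, Module.apply_evalEquiv_symm_apply]
    rfl
  have hext : ∀ x y : V ⧸ Submodule.span F {e},
      (∀ a : Module.Dual F (V ⧸ Submodule.span F {e}), a x = a y) → x = y :=
    fun x y h => sub_eq_zero.mp
      ((Module.forall_dual_apply_eq_zero_iff F _).1 fun a => by rw [map_sub, h, sub_self])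
  refine ⟨W, fun x => hext _ _ fun a => by rw [hW, hω, map_zero], ?_, ?_, ?_⟩
  · refine LinearMap.ext fun t => hext _ _ fun a => ?_
    rw [hW, hωe]
    rfl
  · intro M N hMN heM s hs t ht
    by_contra h
    obtain ⟨a, ha, haM⟩ := Submodule.exists_le_ker_of_notMem h
    refine ha ?_
    rw [hW]
    exact hωP a M N hMN heM (fun x hx => haM (Submodule.mem_map_of_mem hx)) s hs t ht
  · intro s t hs hts h
    obtain ⟨M, heM, hM⟩ := hP.exists_line he (finrank_span_pair_of_notMem hs hts)
    have hMe : M ≤ Submodule.span F {e} := by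
      intro x hx
      rw [← Submodule.ker_mkQ (Submodule.span F {e}), LinearMap.mem_ker]
      refine hext _ _ fun a => ?_
      rw [map_zero]
      refine hωP' a M _ hM heM s (Submodule.subset_span (by simp)) t
        (Submodule.subset_span (by simp)) hts hs ?_ hx
      rw [← hW, h, map_zero]
    have h1 := Submodule.finrank_mono hMe
    rw [hP.finrank_left hM, finrank_span_singleton he] at h1
    omega

end Bilinear

section Wedge

variable {F V}

open Module (finrank)

/-- The wedge `u ∧ v` as a bilinear map into `⋀²V`. -/
noncomputable def wedge : V →ₗ[F] V →ₗ[F] ↥(⋀[F]^2 V) :=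
  LinearMap.mk₂ F
    (fun u v => ⟨ι F u * ι F v, by
      rw [exteriorPower, pow_two]
      exact Submodule.mul_mem_mul ⟨u, rfl⟩ ⟨v, rfl⟩⟩)
    (fun _ _ _ => Subtype.ext (by simp [add_mul]))
    (fun _ _ _ => Subtype.ext (by simp))
    (fun _ _ _ => Subtype.ext (by simp [mul_add]))
    (fun _ _ _ => Subtype.ext (by simp))

theorem coe_wedge (u v : V) : (wedge u v : ↥(⋀[F]^2 V)) = ι F u * ι F v := rfl

theorem wedge_self (u : V) : wedge (F := F) u u = 0 := Subtype.ext (by simp [coe_wedge])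

theorem eq_wedge_iff (x : ↥(⋀[F]^2 V)) (u v : V) :
    (x : ExteriorAlgebra F V) = ι F u * ι F v ↔ x = wedge u v := by
  rw [Subtype.ext_iff, coe_wedge]

theorem apply_anticomm {Q : Type*} [AddCommGroup Q] [Module F Q] {W : V →ₗ[F] V →ₗ[F] Q}
    (hW : ∀ x, W x x = 0) (x y : V) : W x y = - W y x := by
  have h := hW (x + y)
  simp only [map_add, LinearMap.add_apply, hW, zero_add, add_zero] at h
  rw [add_comm] at h
  exact eq_neg_of_add_eq_zero_left h

/-- Alternating bilinear maps factor through `⋀²V`. -/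
theorem exists_lift_wedge {Q : Type*} [AddCommGroup Q] [Module F Q] (W : V →ₗ[F] V →ₗ[F] Q)
    (hW : ∀ x, W x x = 0) : ∃ L : ↥(⋀[F]^2 V) →ₗ[F] Q, ∀ u v, L (wedge u v) = W u v := by
  let A : V [⋀^Fin 2]→ₗ[F] Q :=
    { toFun := fun v => W (v 0) (v 1)
      map_update_add' := by
        intro _ m i x y
        fin_cases i <;> simp [Function.update]
      map_update_smul' := by
        intro _ m i c x
        fin_cases i <;> simp [Function.update]
      map_eq_zero_of_eq' := by
        intro v i j hv hij
        fin_cases i <;> fin_cases j <;> simp_all }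
  refine ⟨exteriorPower.alternatingMapLinearEquiv A, fun u v => ?_⟩
  have h : wedge u v = exteriorPower.ιMulti F 2 ![u, v] := by
    apply Subtype.ext
    simp [coe_wedge, ExteriorAlgebra.ιMulti_apply]
  rw [h, exteriorPower.alternatingMapLinearEquiv_apply_ιMulti]
  rfl

theorem mem_span_singleton_of_wedge_eq_zero [FiniteDimensional F V] {u v : V} (hu : u ≠ 0)
    (h : wedge (F := F) u v = 0) : v ∈ Submodule.span F {u} := by
  by_contra hv
  obtain ⟨φ, hφv, hφ⟩ := Submodule.exists_le_ker_of_notMem hv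
  have hφu : φ u = 0 := hφ (Submodule.mem_span_singleton_self u)
  obtain ⟨ψ, hψu⟩ : ∃ ψ : Module.Dual F V, ψ u ≠ 0 := by
    by_contra! hc
    exact hu ((Module.forall_dual_apply_eq_zero_iff F u).1 hc)
  obtain ⟨L, hL⟩ := exists_lift_wedge (φ.smulRight ψ - ψ.smulRight φ)
    (fun x => by simp [mul_comm])
  have := hL u v
  rw [h, map_zero] at this
  simp [hφu, hφv, hψu] at this

/-- The image of the Plücker point of a line through `q ≠ 0` under a linear map on `⋀²V`. -/
theorem mem_map_plueckerPoint {Q : Type*} [AddCommGroup Q] [Module F Q] [FiniteDimensional F V]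
    (L : ↥(⋀[F]^2 V) →ₗ[F] Q) {N : Submodule F V} (hN : finrank F N = 2) {q : V} (hq : q ≠ 0)
    (hqN : q ∈ N) (x : Q) :
    x ∈ (plueckerPoint F V N).map L ↔ ∃ n ∈ N, x = L (wedge q n) := by
  obtain ⟨r, hrN, hr⟩ := exists_mem_notMem_of_finrank_lt (A := Submodule.span F {q}) (B := N)
    (by rw [finrank_span_singleton hq]; omega)
  have hspan : Submodule.span F {q, r} = N := by
    apply Submodule.eq_of_le_of_finrank_eq
    · rw [Submodule.span_le]
      rintro x (rfl | rfl)
      exacts [hqN, hrN]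
    · rw [finrank_span_pair_of_notMem hq hr, hN]
  have hle : plueckerPoint F V N ≤ N.map (wedge q) := by
    rw [plueckerPoint, Submodule.span_le]
    rintro x ⟨u, hu, v, hv, hx⟩
    rw [eq_wedge_iff] at hx
    rw [← hspan, Submodule.mem_span_pair] at hu hv
    obtain ⟨a, b, rfl⟩ := hu
    obtain ⟨c, d, rfl⟩ := hv
    refine ⟨(a * d - b * c) • r, N.smul_mem _ hrN, ?_⟩
    rw [hx]
    simp only [map_add, map_smul, LinearMap.add_apply, LinearMap.smul_apply, wedge_self,
      apply_anticomm (wedge_self (F := F)) r q]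
    module
  constructor
  · rintro ⟨y, hy, rfl⟩
    obtain ⟨n, hn, rfl⟩ := hle hy
    exact ⟨n, hn, rfl⟩
  · rintro ⟨n, hn, rfl⟩
    exact Submodule.mem_map_of_mem (Submodule.subset_span ⟨q, hqN, n, hn, rfl⟩)

/-- Lines with equal images modulo an external plane satisfy the condition of crossed pencils. -/
theorem IsExternalPlane.mem_sup_of_sup_eq [FiniteDimensional F V]
    {C : Submodule F ↥(⋀[F]^2 V)} (hC : IsExternalPlane F V C)
    {M₁ M₂ N₁ N₂ : Submodule F V} (hM₁ : finrank F M₁ = 2) (hM₂ : finrank F M₂ = 2)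
    (hN₁ : finrank F N₁ = 2) (hN₂ : finrank F N₂ = 2)
    (h₁ : C ⊔ plueckerPoint F V M₁ = C ⊔ plueckerPoint F V N₁)
    (h₂ : C ⊔ plueckerPoint F V M₂ = C ⊔ plueckerPoint F V N₂)
    {p q : V} (hp : p ≠ 0) (hq : q ≠ 0) (hpM₁ : p ∈ M₁) (hpM₂ : p ∈ M₂) (hqN₁ : q ∈ N₁)
    (hqN₂ : q ∈ N₂) (hqM : q ∈ M₁ ⊔ M₂) : p ∈ N₁ ⊔ N₂ := by
  have hmap : ∀ {A B : Submodule F ↥(⋀[F]^2 V)}, C ⊔ A = C ⊔ B → A.map C.mkQ = B.map C.mkQ := by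
    intro A B h
    simpa [Submodule.map_sup, Submodule.mkQ_map_self] using congrArg (Submodule.map C.mkQ) h
  obtain ⟨m₁, hm₁, m₂, hm₂, rfl⟩ := Submodule.mem_sup.mp hqM
  obtain ⟨n₁, hn₁, e₁⟩ := (mem_map_plueckerPoint C.mkQ hN₁ hq hqN₁ _).1
    (hmap h₁ ▸ (mem_map_plueckerPoint C.mkQ hM₁ hp hpM₁ _).2 ⟨m₁, hm₁, rfl⟩)
  obtain ⟨n₂, hn₂, e₂⟩ := (mem_map_plueckerPoint C.mkQ hN₂ hq hqN₂ _).1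
    (hmap h₂ ▸ (mem_map_plueckerPoint C.mkQ hM₂ hp hpM₂ _).2 ⟨m₂, hm₂, rfl⟩)
  set q := m₁ + m₂ with hqdef
  have hmem : wedge q (p + (n₁ + n₂)) ∈ C := by
    have h : wedge (F := F) q p = - (wedge p m₁ + wedge p m₂) := by
      rw [apply_anticomm (wedge_self (F := F)) q p, ← map_add]
    rw [← Submodule.ker_mkQ C, LinearMap.mem_ker, map_add (wedge q) p, map_add (wedge q) n₁, h]
    simp only [map_add, map_neg, e₁, e₂]
    abel
  have hzero : wedge (F := F) q (p + (n₁ + n₂)) = 0 := by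
    by_contra h
    exact hC.2 _ hmem h ⟨_, _, rfl⟩
  obtain ⟨c, hc⟩ := Submodule.mem_span_singleton.mp (mem_span_singleton_of_wedge_eq_zero hq hzero)
  have hpeq : p = (c • q - n₁) + (- n₂) := by rw [hc]; abel
  rw [hpeq]
  exact Submodule.add_mem_sup (N₁.sub_mem (N₁.smul_mem c hqN₁) hn₁) (N₂.neg_mem hn₂)

/-- A parallelism satisfying the condition of crossed pencils is Clifford. -/
theorem CrossedPencils.exists_isExternalPlane [FiniteDimensional F V]
    {P : Submodule F V → Submodule F V → Prop} (hC : CrossedPencils P) (hP : IsParallelism P)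
    (hV : finrank F V = 4) :
    ∃ C : Submodule F ↥(⋀[F]^2 V), IsExternalPlane F V C ∧
      ∀ M N : Submodule F V, finrank F M = 2 → finrank F N = 2 →
        (P M N ↔ C ⊔ plueckerPoint F V M = C ⊔ plueckerPoint F V N) := by
  obtain ⟨e, he⟩ : ∃ e : V, e ≠ 0 := by
    have : Nontrivial V := Module.nontrivial_of_finrank_pos (R := F) (by omega)
    exact exists_ne 0
  obtain ⟨W, hW, hWe, hWP, hW0⟩ := hC.exists_alternating hP hV he
  obtain ⟨L, hL⟩ := exists_lift_wedge W hW
  set π := (Submodule.span F {e}).mkQ with hπ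
  have hrange : LinearMap.range L = ⊤ := by
    rw [LinearMap.range_eq_top]
    intro x
    obtain ⟨t, rfl⟩ := Submodule.mkQ_surjective _ x
    exact ⟨wedge e t, by rw [hL, hWe]⟩
  have hmap : ∀ {M K : Submodule F V}, P M K → e ∈ K → (plueckerPoint F V M).map L = K.map π := by
    intro M K hMK heK
    have hM := hP.finrank_left hMK
    obtain ⟨q, hqM, hq⟩ := exists_mem_notMem_of_finrank_lt (A := (⊥ : Submodule F V)) (B := M)
      (by rw [finrank_bot]; omega)
    rw [Submodule.mem_bot] at hq
    obtain ⟨r, hrM, hr⟩ := exists_mem_notMem_of_finrank_lt (A := Submodule.span F {q}) (B := M)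
      (by rw [finrank_span_singleton hq]; omega)
    apply Submodule.eq_of_le_of_finrank_le
    · intro x hx
      obtain ⟨n, hn, rfl⟩ := (mem_map_plueckerPoint L hM hq hqM x).1 hx
      rw [hL]
      exact hWP K M (hP.symm hMK) heK q hqM n hn
    · have h1 : finrank F ↥(K.map π) ≤ 1 := by
        have h2 := LinearMap.finrank_range_add_finrank_ker (π.domRestrict K)
        have h3 : 1 ≤ finrank F ↥(LinearMap.ker (π.domRestrict K)) := by
          rw [Nat.one_le_iff_ne_zero, ne_eq, Submodule.finrank_eq_zero, Submodule.eq_bot_iff]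
          intro h
          have h4 := h ⟨e, heK⟩ (by simp [hπ])
          exact he (congrArg Subtype.val h4)
        rw [LinearMap.range_domRestrict, hP.finrank_right hMK] at h2
        omega
      refine h1.trans ?_
      rw [Nat.one_le_iff_ne_zero, ne_eq, Submodule.finrank_eq_zero]
      intro h
      have h2 : L (wedge q r) ∈ (plueckerPoint F V M).map L :=
        (mem_map_plueckerPoint L hM hq hqM _).2 ⟨r, hrM, rfl⟩
      rw [h, Submodule.mem_bot, hL] at h2
      exact hW0 q r hq hr h2
  refine ⟨LinearMap.ker L, ⟨?_, ?_⟩, ?_⟩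
  · have h1 := LinearMap.finrank_range_add_finrank_ker L
    have h2 := Submodule.finrank_quotient_add_finrank (Submodule.span F {e})
    rw [finrank_span_singleton he, hV] at h2
    rw [hrange, finrank_top, exteriorPower.finrank_eq, hV, show Nat.choose 4 2 = 6 from rfl] at h1
    omega
  · rintro x hx hx0 ⟨u, v, huv⟩
    rw [eq_wedge_iff] at huv
    subst huv
    rw [LinearMap.mem_ker, hL] at hx
    have hu : u ≠ 0 := by
      rintro rfl
      simp at hx0
    refine hW0 u v hu ?_ hx
    intro hv
    obtain ⟨c, rfl⟩ := Submodule.mem_span_singleton.mp hv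
    simp [wedge_self] at hx0
  · intro M N hM hN
    obtain ⟨K, heK, hKM⟩ := hP.exists_line he hM
    obtain ⟨K', heK', hKN⟩ := hP.exists_line he hN
    have hsup : ∀ A : Submodule F ↥(⋀[F]^2 V), LinearMap.ker L ⊔ A = (A.map L).comap L := by
      intro A
      rw [Submodule.comap_map_eq, sup_comm]
    have hcomap : ∀ {K : Submodule F V}, e ∈ K → (K.map π).comap π = K := by
      intro K h
      rw [Submodule.comap_map_eq, hπ, Submodule.ker_mkQ, sup_eq_left]
      simpa [Submodule.span_le] using h
    rw [hsup, hsup, hmap (hP.symm hKM) heK, hmap (hP.symm hKN) heK']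
    constructor
    · intro h
      rw [hP.unique (hP.trans hKM (hP.trans h (hP.symm hKN))) he heK heK']
    · intro h
      have h1 : K = K' := by
        rw [← hcomap heK, ← hcomap heK',
          Submodule.comap_injective_of_surjective (LinearMap.range_eq_top.mp hrange) h]
      subst h1
      exact hP.trans (hP.symm hKM) hKN

end Wedge

/-- A parallelism of `P(V)` is Clifford (induced by a plane external to the Klein quadric)
iff it satisfies the condition of crossed pencils. -/
theorem clifford_iff_crossed_pencils
    [FiniteDimensional F V] (hV : Module.finrank F V = 4)
    (P : Submodule F V → Submodule F V → Prop)
    (hrel : ∀ M N : Submodule F V, P M N → Module.finrank F M = 2 ∧ Module.finrank F N = 2)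
    (hrefl : ∀ M : Submodule F V, Module.finrank F M = 2 → P M M)
    (hsymm : ∀ M N : Submodule F V, P M N → P N M)
    (htrans : ∀ L M N : Submodule F V, P L M → P M N → P L N)
    (hpar : ∀ p M : Submodule F V, Module.finrank F p = 1 → Module.finrank F M = 2 →
      ∃! N : Submodule F V, Module.finrank F N = 2 ∧ p ≤ N ∧ P N M) :
    (∃ C : Submodule F ↥(⋀[F]^2 V), IsExternalPlane F V C ∧
        ∀ M N : Submodule F V, Module.finrank F M = 2 → Module.finrank F N = 2 →
          (P M N ↔ C ⊔ plueckerPoint F V M = C ⊔ plueckerPoint F V N)) ↔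
    (∀ M₁ M₂ N₁ N₂ : Submodule F V,
      Module.finrank F M₁ = 2 → Module.finrank F M₂ = 2 →
      Module.finrank F N₁ = 2 → Module.finrank F N₂ = 2 →
      P M₁ N₁ → P M₂ N₂ →
      Module.finrank F ↥(M₁ ⊓ M₂) = 1 → Module.finrank F ↥(N₁ ⊓ N₂) = 1 →
      M₁ ⊓ M₂ ≠ N₁ ⊓ N₂ →
      N₁ ⊓ N₂ ≤ M₁ ⊔ M₂ → M₁ ⊓ M₂ ≤ N₁ ⊔ N₂) := by
  have hP : IsParallelism P :=
    { finrank_left := fun h => (hrel _ _ h).1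
      finrank_right := fun h => (hrel _ _ h).2
      refl := fun h => hrefl _ h
      symm := fun h => hsymm _ _ h
      trans := fun h h' => htrans _ _ _ h h'
      exists_line := by
        intro v M hv hM
        obtain ⟨N, ⟨-, hN, hNM⟩, -⟩ := hpar _ M (finrank_span_singleton hv) hM
        exact ⟨N, hN (Submodule.mem_span_singleton_self v), hNM⟩
      unique := by
        intro v M N hMN hv hvM hvN
        obtain ⟨hM, hN⟩ := hrel _ _ hMN
        refine (hpar _ N (finrank_span_singleton hv) hN).unique ⟨hM, ?_, hMN⟩
          ⟨hN, ?_, hrefl N hN⟩ <;> simpa [Submodule.span_le] }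
  constructor
  · rintro ⟨C, hC, hCP⟩ M₁ M₂ N₁ N₂ hM₁ hM₂ hN₁ hN₂ h₁ h₂ hM hN - hle
    obtain ⟨p, hp, hspan⟩ := finrank_eq_one_iff'.mp hM
    obtain ⟨q, hq, -⟩ := finrank_eq_one_iff'.mp hN
    intro x hx
    obtain ⟨c, hc⟩ := hspan ⟨x, hx⟩
    have hxp : x = c • (p : V) := (congrArg Subtype.val hc).symm
    rw [hxp]
    apply Submodule.smul_mem
    exact hC.mem_sup_of_sup_eq hM₁ hM₂ hN₁ hN₂ ((hCP _ _ hM₁ hN₁).1 h₁) ((hCP _ _ hM₂ hN₂).1 h₂)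
      (by simpa using hp) (by simpa using hq) p.2.1 p.2.2 q.2.1 q.2.2 (hle q.2)
  · intro h
    refine CrossedPencils.exists_isExternalPlane ?_ hP hV
    intro M₁ M₂ N₁ N₂ p q h₁ h₂ hne hp hq hpM₁ hpM₂ hqN₁ hqN₂ hqp hle
    obtain ⟨hM₁, hN₁⟩ := hrel _ _ h₁
    obtain ⟨hM₂, hN₂⟩ := hrel _ _ h₂
    have hne' : N₁ ≠ N₂ := by
      rintro rfl
      exact hne (hP.unique (hP.trans h₁ (hP.symm h₂)) hp hpM₁ hpM₂)
    have hMp := inf_eq_span_of_ne hM₁ hM₂ hne hp hpM₁ hpM₂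
    have hNq := inf_eq_span_of_ne hN₁ hN₂ hne' hq hqN₁ hqN₂
    refine h M₁ M₂ N₁ N₂ hM₁ hM₂ hN₁ hN₂ h₁ h₂
      (finrank_inf_of_ne hM₁ hM₂ hne hp hpM₁ hpM₂) (finrank_inf_of_ne hN₁ hN₂ hne' hq hqN₁ hqN₂)
      ?_ ?_ ⟨hpM₁, hpM₂⟩
    · rw [hMp, hNq]
      intro heq
      exact hqp (heq ▸ Submodule.mem_span_singleton_self q)
    · rw [hNq]
      simpa [Submodule.span_le] using hle
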